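/- arXiv:math-ph/0501043 — 2 statements merged into one kernel-verified Lean document; each statement's English description precedes it below -/
import Mathlib

section
/- Let β > -1, c > 0 and p > 0 be real. Suppose M : (0,1) → ℕ satisfies x^{M(x)} ≤ (1-x)^p for all x near 1 and M(x) → ∞ as x → 1⁻. Then the ratio [-Σ_{k > M(x)} c·k^β · log(1-x^k)] / [c·M(x)^β · x^{M(x)} / (1-x)] tends to 1 as x → 1⁻. -/
open Filter Topology

lemma exp_neg_abs_mul_le_one_add_rpow (β : ℝ) {t : ℝ} (ht : 0 ≤ t) :
    Real.exp (-|β| * t) ≤ (1 + t) ^ β := by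
  rw [Real.rpow_def_of_pos (by linarith)]
  apply Real.exp_le_exp.2
  have h0 : 0 ≤ Real.log (1 + t) := Real.log_nonneg (by linarith)
  have h1 : Real.log (1 + t) ≤ t := by
    have := Real.log_le_sub_one_of_pos (show 0 < 1 + t by linarith)
    linarith
  nlinarith [mul_le_mul_of_nonneg_left (neg_abs_le β) h0,
    mul_le_mul_of_nonneg_left h1 (abs_nonneg β)]

lemma one_add_rpow_le_exp_abs_mul (β : ℝ) {t : ℝ} (ht : 0 ≤ t) :
    (1 + t) ^ β ≤ Real.exp (|β| * t) := by
  rw [Real.rpow_def_of_pos (by linarith)]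
  apply Real.exp_le_exp.2
  have h0 : 0 ≤ Real.log (1 + t) := Real.log_nonneg (by linarith)
  have h1 : Real.log (1 + t) ≤ t := by
    have := Real.log_le_sub_one_of_pos (show 0 < 1 + t by linarith)
    linarith
  nlinarith [mul_le_mul_of_nonneg_left (le_abs_self β) h0,
    mul_le_mul_of_nonneg_left h1 (abs_nonneg β)]

lemma le_neg_log_one_sub {u : ℝ} (hu : u < 1) : u ≤ -Real.log (1 - u) := by
  have := Real.log_le_sub_one_of_pos (show 0 < 1 - u by linarith)
  linarith

lemma neg_log_one_sub_le {u : ℝ} (hu : u < 1) : -Real.log (1 - u) ≤ u / (1 - u) := by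
  have h : 0 < 1 - u := by linarith
  have := Real.one_sub_inv_le_log_of_pos h
  have e : u / (1 - u) = (1 - u)⁻¹ - 1 := by field_simp; ring
  linarith

lemma rpow_natCast_add (β : ℝ) {m : ℕ} (hm : 0 < m) (i : ℕ) :
    ((m + i : ℕ) : ℝ) ^ β = (m : ℝ) ^ β * (1 + i / m) ^ β := by
  have hm' : (0 : ℝ) < m := by exact_mod_cast hm
  rw [← Real.mul_rpow hm'.le (by positivity)]
  congr 1
  push_cast
  field_simp

lemma mul_exp_div_pow (x b m : ℝ) (i : ℕ) :
    (x * Real.exp (b / m)) ^ i = x ^ i * Real.exp (b * (i / m)) := by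
  rw [mul_pow, ← Real.exp_nat_mul]
  congr 2
  ring

lemma tail_term_lower {β c x : ℝ} (hc : 0 < c) (hx0 : 0 < x) (hx1 : x < 1) {m : ℕ}
    (hm : 0 < m) {i : ℕ} (hi : i ≠ 0) :
    c * (m : ℝ) ^ β * x ^ m * (x * Real.exp (-|β| / m)) ^ i
      ≤ c * ((m + i : ℕ) : ℝ) ^ β * -Real.log (1 - x ^ (m + i)) := by
  have hu : x ^ (m + i) < 1 := pow_lt_one₀ hx0.le hx1 (by omega)
  rw [mul_exp_div_pow, rpow_natCast_add β hm]
  have h1 := exp_neg_abs_mul_le_one_add_rpow β (t := (i : ℝ) / m) (by positivity)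
  calc _ = c * ((m : ℝ) ^ β * Real.exp (-|β| * (i / m))) * x ^ (m + i) := by ring
    _ ≤ _ := by
      gcongr
      exact le_neg_log_one_sub hu

lemma tail_term_upper {β c x : ℝ} (hc : 0 < c) (hx0 : 0 < x) (hx1 : x < 1) {m : ℕ}
    (hm : 0 < m) (i : ℕ) :
    c * ((m + i : ℕ) : ℝ) ^ β * -Real.log (1 - x ^ (m + i))
      ≤ c * (m : ℝ) ^ β * x ^ m / (1 - x ^ m) * (x * Real.exp (|β| / m)) ^ i := by
  have hum : x ^ m < 1 := pow_lt_one₀ hx0.le hx1 hm.ne'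
  have hle : x ^ (m + i) ≤ x ^ m := pow_le_pow_of_le_one hx0.le hx1.le (by omega)
  have hpos : 0 < 1 - x ^ m := by linarith
  rw [mul_exp_div_pow, rpow_natCast_add β hm]
  have h1 := one_add_rpow_le_exp_abs_mul β (t := (i : ℝ) / m) (by positivity)
  have h2 : -Real.log (1 - x ^ (m + i)) ≤ x ^ (m + i) / (1 - x ^ m) :=
    (neg_log_one_sub_le (by linarith)).trans (by gcongr)
  have h3 : 0 ≤ -Real.log (1 - x ^ (m + i)) :=
    le_trans (by positivity) (le_neg_log_one_sub (u := x ^ (m + i)) (by linarith))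
  calc _ ≤ c * ((m : ℝ) ^ β * Real.exp (|β| * (i / m))) * (x ^ (m + i) / (1 - x ^ m)) := by
        gcongr
    _ = _ := by ring

lemma tsum_ite_lt_eq_tsum_add (f : ℕ → ℝ) (m : ℕ) :
    ∑' k, (if m < k then f k else 0) = ∑' j, f (m + (j + 1)) := by
  have hinj : Function.Injective (fun j : ℕ => m + (j + 1)) := fun a b h => by
    simp only at h; omega
  rw [← hinj.tsum_eq (f := fun k => if m < k then f k else 0)]
  · refine tsum_congr fun j => ?_
    rw [if_pos (by omega)]
  · intro k hk
    have hk' : m < k := by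
      by_contra h
      simp [h] at hk
    exact ⟨k - m - 1, by simp only; omega⟩

lemma hasSum_geometric_succ {r : ℝ} (h0 : 0 ≤ r) (h1 : r < 1) :
    HasSum (fun j : ℕ => r ^ (j + 1)) (r / (1 - r)) := by
  simpa [pow_succ', div_eq_mul_inv] using (hasSum_geometric_of_lt_one h0 h1).mul_left r

lemma tail_ratio_bounds {β c x : ℝ} (hc : 0 < c) (hx0 : 0 < x) (hx1 : x < 1) {m : ℕ}
    (hm : 0 < m) (hz : x * Real.exp (|β| / m) < 1) :
    (1 - x) * ((x * Real.exp (-|β| / m)) / (1 - x * Real.exp (-|β| / m)))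
        ≤ (-∑' k : ℕ, if m < k then c * (k : ℝ) ^ β * Real.log (1 - x ^ k) else 0)
          / (c * (m : ℝ) ^ β * x ^ m / (1 - x)) ∧
      (-∑' k : ℕ, if m < k then c * (k : ℝ) ^ β * Real.log (1 - x ^ k) else 0)
          / (c * (m : ℝ) ^ β * x ^ m / (1 - x))
        ≤ (1 - x) * ((x * Real.exp (|β| / m)) / (1 - x * Real.exp (|β| / m)))
          / (1 - x ^ m) := by
  have hm' : (0 : ℝ) < m := by exact_mod_cast hm
  have hx : 0 < 1 - x := by linarith
  have hum : 0 < 1 - x ^ m := by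
    have := pow_lt_one₀ hx0.le hx1 hm.ne'
    linarith
  have hy : x * Real.exp (-|β| / m) < 1 := by
    refine lt_of_le_of_lt ?_ hz
    gcongr
    linarith [abs_nonneg β]
  have hY := (hasSum_geometric_succ (by positivity) hy).mul_left (c * (m : ℝ) ^ β * x ^ m)
  have hZ := (hasSum_geometric_succ (by positivity) hz).mul_left
    (c * (m : ℝ) ^ β * x ^ m / (1 - x ^ m))
  have hlow := fun j : ℕ => tail_term_lower (β := β) hc hx0 hx1 hm (Nat.succ_ne_zero j)
  have hup := fun j : ℕ => tail_term_upper (β := β) hc hx0 hx1 hm (j + 1)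
  have hS : Summable fun j : ℕ =>
      c * ((m + (j + 1) : ℕ) : ℝ) ^ β * -Real.log (1 - x ^ (m + (j + 1))) :=
    Summable.of_nonneg_of_le (fun j => le_trans (by positivity) (hlow j)) hup hZ.summable
  have hD : 0 < c * (m : ℝ) ^ β * x ^ m / (1 - x) := by positivity
  rw [tsum_ite_lt_eq_tsum_add (fun k => c * (k : ℝ) ^ β * Real.log (1 - x ^ k)), ← tsum_neg]
  simp only [← mul_neg]
  constructor
  · rw [le_div_iff₀ hD]
    refine le_trans (le_of_eq ?_) (hasSum_le hlow hY hS.hasSum)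
    field_simp
  · rw [div_le_iff₀ hD]
    refine le_trans (hasSum_le hup hS.hasSum hZ) (le_of_eq ?_)
    field_simp

lemma tendsto_mul_one_sub_atTop {p : ℝ} (hp : 0 < p) {M : ℝ → ℕ}
    (hM : ∀ᶠ x in 𝓝[<] (1 : ℝ), x ^ (M x) ≤ (1 - x) ^ p) :
    Tendsto (fun x : ℝ => (M x : ℝ) * (1 - x)) (𝓝[<] (1 : ℝ)) atTop := by
  have h1 : Tendsto (fun x : ℝ => 1 - x) (𝓝[<] (1 : ℝ)) (𝓝[>] 0) := by
    refine tendsto_nhdsWithin_iff.2 ⟨?_, ?_⟩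
    · have : Tendsto (fun x : ℝ => 1 - x) (𝓝 (1 : ℝ)) (𝓝 (1 - 1)) :=
        (continuous_const.sub continuous_id).tendsto 1
      rw [sub_self] at this
      exact this.mono_left nhdsWithin_le_nhds
    · filter_upwards [self_mem_nhdsWithin] with x hx
      exact Set.mem_Ioi.2 (sub_pos.2 (Set.mem_Iio.1 hx))
  have h2 : Tendsto (fun x : ℝ => -(p / 2) * Real.log (1 - x)) (𝓝[<] (1 : ℝ)) atTop :=
    (Real.tendsto_log_nhdsGT_zero.comp h1).const_mul_atBot_of_neg (by linarith)
  refine tendsto_atTop_mono' _ ?_ h2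
  filter_upwards [hM, self_mem_nhdsWithin,
    mem_nhdsWithin_of_mem_nhds (Ioi_mem_nhds (show (1 / 2 : ℝ) < 1 by norm_num))] with x hx hx1 hx2
  have hx1 : x < 1 := hx1
  have hx2 : 1 / 2 < x := hx2
  have hx0 : 0 < x := by linarith
  have hlog := Real.log_le_log (by positivity) hx
  rw [Real.log_pow, Real.log_rpow (by linarith)] at hlog
  have h3 : -(2 * (1 - x)) ≤ Real.log x := by
    refine le_trans ?_ (Real.one_sub_inv_le_log_of_pos hx0)
    have : x⁻¹ ≤ 2 := by
      rw [inv_le_comm₀ hx0 (by norm_num)]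
      linarith
    have hxx : x⁻¹ * x = 1 := inv_mul_cancel₀ hx0.ne'
    nlinarith
  have := mul_le_mul_of_nonneg_left h3 (Nat.cast_nonneg (α := ℝ) (M x))
  linarith

lemma tendsto_one_sub_mul_exp_div_one_sub (b : ℝ) {M : ℝ → ℕ}
    (hMtop : Tendsto (fun x : ℝ => (M x : ℝ)) (𝓝[<] (1 : ℝ)) atTop)
    (hA : Tendsto (fun x : ℝ => (M x : ℝ) * (1 - x)) (𝓝[<] (1 : ℝ)) atTop) :
    Tendsto (fun x : ℝ => (1 - x * Real.exp (b / M x)) / (1 - x)) (𝓝[<] (1 : ℝ)) (𝓝 1) := by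
  have hid : Tendsto (fun x : ℝ => x) (𝓝[<] (1 : ℝ)) (𝓝 1) := nhdsWithin_le_nhds
  have hs : Tendsto (fun x : ℝ => b / M x) (𝓝[<] (1 : ℝ)) (𝓝 0) := hMtop.const_div_atTop b
  have hsmall : Tendsto (fun x : ℝ => (Real.exp (b / M x) - 1) / (1 - x))
      (𝓝[<] (1 : ℝ)) (𝓝 0) := by
    refine squeeze_zero_norm' ?_ (hA.const_div_atTop (2 * |b|))
    have hs1 : ∀ᶠ x in 𝓝[<] (1 : ℝ), |b / M x| < 1 := by
      have := hs.abs
      rw [abs_zero] at this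
      exact this.eventually_lt_const one_pos
    filter_upwards [hs1, self_mem_nhdsWithin] with x hx hx1
    have hx1 : 0 < 1 - x := sub_pos.2 hx1
    rw [Real.norm_eq_abs, abs_div, abs_of_pos hx1]
    calc _ ≤ 2 * |b / M x| / (1 - x) := by
          gcongr
          exact Real.abs_exp_sub_one_le hx.le
      _ = _ := by
          rw [abs_div, Nat.abs_cast, ← mul_div_assoc, div_div]
  have := (tendsto_const_nhds (x := (1 : ℝ))).sub (hid.mul hsmall)
  rw [mul_zero, sub_zero] at this
  refine this.congr' ?_
  filter_upwards [self_mem_nhdsWithin] with x hx1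
  have hx1 : 1 - x ≠ 0 := (sub_pos.2 hx1).ne'
  field_simp
  ring

lemma tendsto_one_sub_mul_geometric (b : ℝ) {M : ℝ → ℕ}
    (hMtop : Tendsto (fun x : ℝ => (M x : ℝ)) (𝓝[<] (1 : ℝ)) atTop)
    (hA : Tendsto (fun x : ℝ => (M x : ℝ) * (1 - x)) (𝓝[<] (1 : ℝ)) atTop) :
    Tendsto (fun x : ℝ =>
        (1 - x) * ((x * Real.exp (b / M x)) / (1 - x * Real.exp (b / M x))))
      (𝓝[<] (1 : ℝ)) (𝓝 1) := by
  have hid : Tendsto (fun x : ℝ => x) (𝓝[<] (1 : ℝ)) (𝓝 1) := nhdsWithin_le_nhds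
  have hs : Tendsto (fun x : ℝ => b / M x) (𝓝[<] (1 : ℝ)) (𝓝 0) := hMtop.const_div_atTop b
  have := (hid.mul hs.rexp).div
    (tendsto_one_sub_mul_exp_div_one_sub b hMtop hA) one_ne_zero
  rw [Real.exp_zero, mul_one, div_one] at this
  refine this.congr fun x => ?_
  simp only [Pi.div_apply, div_div_eq_mul_div]
  ring

/-- In the generalized Bose–Einstein statistics with `b_k = c k^β`, if
`x^{M(x)} ≤ (1-x)^p` near `1` and `M(x) → ∞`, then
`-∑_{k > M(x)} c k^β log(1-x^k)` is asymptotically `c M(x)^β x^{M(x)}/(1-x)`. -/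
theorem stmt_3 (β c p : ℝ) (hβ : -1 < β) (hc : 0 < c) (hp : 0 < p)
    (M : ℝ → ℕ)
    (hM : ∀ᶠ x in 𝓝[<] (1 : ℝ), x ^ (M x) ≤ (1 - x) ^ p)
    (hMtop : Tendsto (fun x : ℝ => (M x : ℝ)) (𝓝[<] (1 : ℝ)) atTop) :
    Tendsto (fun x : ℝ =>
        (-∑' k : ℕ, if M x < k then c * (k : ℝ) ^ β * Real.log (1 - x ^ k) else 0)
          / (c * (M x : ℝ) ^ β * x ^ (M x) / (1 - x)))
      (𝓝[<] (1 : ℝ)) (𝓝 1) := by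
  have hA := tendsto_mul_one_sub_atTop hp hM
  have hx0 : ∀ᶠ x in 𝓝[<] (1 : ℝ), 0 < x :=
    mem_nhdsWithin_of_mem_nhds (Ioi_mem_nhds one_pos)
  have hpow : Tendsto (fun x : ℝ => x ^ M x) (𝓝[<] (1 : ℝ)) (𝓝 0) := by
    have h1 : Tendsto (fun x : ℝ => (1 - x) ^ p) (𝓝[<] (1 : ℝ)) (𝓝 0) := by
      have h : Tendsto (fun x : ℝ => (1 - x) ^ p) (𝓝 (1 : ℝ)) (𝓝 ((1 - 1) ^ p)) :=
        ((continuous_const.sub continuous_id).rpow_const fun _ => Or.inr hp.le).tendsto 1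
      rw [sub_self, Real.zero_rpow hp.ne'] at h
      exact h.mono_left nhdsWithin_le_nhds
    refine squeeze_zero' ?_ hM h1
    filter_upwards [hx0] with x hx
    positivity
  have hlow := tendsto_one_sub_mul_geometric (-|β|) hMtop hA
  have hup := (tendsto_one_sub_mul_geometric |β| hMtop hA).div
    ((tendsto_const_nhds (x := (1 : ℝ))).sub hpow) (by norm_num)
  rw [sub_zero, div_one] at hup
  have hz := (tendsto_one_sub_mul_exp_div_one_sub |β| hMtop hA).eventually_const_lt one_pos
  have hbounds : ∀ᶠ x in 𝓝[<] (1 : ℝ), 0 < x ∧ x < 1 ∧ 0 < M x ∧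
      x * Real.exp (|β| / M x) < 1 := by
    filter_upwards [hx0, self_mem_nhdsWithin, hz, hMtop.eventually_gt_atTop 0]
      with x h0 h1 hz hm
    refine ⟨h0, h1, by exact_mod_cast hm, ?_⟩
    have := (div_pos_iff_of_pos_right (sub_pos.2 h1)).1 hz
    linarith
  refine tendsto_of_tendsto_of_tendsto_of_le_of_le' hlow hup ?_ ?_
  · filter_upwards [hbounds] with x ⟨h0, h1, hm, hz⟩
    exact (tail_ratio_bounds hc h0 h1 hm hz).1
  · filter_upwards [hbounds] with x ⟨h0, h1, hm, hz⟩
    exact (tail_ratio_bounds hc h0 h1 hm hz).2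
end

section
/- Fix an integer d ≥ 1. For a nonnegative integer k let j_d(k) = #{(k_1,…,k_d) ∈ ℤ^d : k_1² + ⋯ + k_d² = k}, and for x ∈ (0,1) set A(x) = (d/2)|log(1-x)| + ((d-2)/2)·log|log(1-x)| + (d/2)·log(d/2) + log(π^{d/2}/Γ(d/2+1)). Then for every real t, ∏_{k ∈ ℕ, k > (A(x)+t)/(1-x)} (1-x^k)^{j_d(k)} → exp(-e^{-t}) as x → 1⁻. -/
open Filter Topology

/-- The integer points in the closed Euclidean ball of radius `√n`. -/
noncomputable def latticeBall (d n : ℕ) : Finset (Fin d → ℤ) :=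
  (Fintype.piFinset fun _ => Finset.Icc (-(n : ℤ)) n).filter fun v => ∑ i, v i ^ 2 ≤ (n : ℤ)

theorem mem_latticeBall {d n : ℕ} {v : Fin d → ℤ} :
    v ∈ latticeBall d n ↔ ∑ i, v i ^ 2 ≤ (n : ℤ) := by
  simp only [latticeBall, Finset.mem_filter, Fintype.mem_piFinset, Finset.mem_Icc,
    and_iff_right_iff_imp]
  intro h i
  have h1 : v i ^ 2 ≤ ∑ j, v j ^ 2 :=
    Finset.single_le_sum (f := fun j => v j ^ 2) (fun j _ => sq_nonneg _) (Finset.mem_univ i)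
  constructor <;> nlinarith

/-- The volume of the Euclidean unit ball in dimension `d`. -/
noncomputable def unitBallVolume (d : ℕ) : ℝ :=
  √Real.pi ^ d / Real.Gamma ((d : ℝ) / 2 + 1)

theorem unitBallVolume_pos (d : ℕ) : 0 < unitBallVolume d := by
  have : 0 < Real.Gamma ((d : ℝ) / 2 + 1) := Real.Gamma_pos_of_pos (by positivity)
  have := Real.pi_pos
  unfold unitBallVolume
  positivity

theorem volume_floor_mem {d : ℕ} (S : Finset (Fin d → ℤ)) :
    MeasureTheory.volume {y : EuclideanSpace ℝ (Fin d) | (fun i => ⌊y i⌋) ∈ S} = S.card := by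
  have hm : ∀ v : Fin d → ℤ, MeasurableSet
      (Set.univ.pi fun i => Set.Ico (v i : ℝ) (v i + 1)) :=
    fun v => MeasurableSet.univ_pi fun i => measurableSet_Ico
  have hset : {y : EuclideanSpace ℝ (Fin d) | (fun i => ⌊y i⌋) ∈ S}
      = WithLp.ofLp ⁻¹' (⋃ v ∈ S, Set.univ.pi fun i => Set.Ico (v i : ℝ) (v i + 1)) := by
    ext y
    simp only [Set.mem_ofPred_eq, Set.mem_preimage, Set.mem_iUnion, Set.mem_pi, Set.mem_univ,
      true_implies, Set.mem_Ico, exists_prop, ← Int.floor_eq_iff]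
    constructor
    · exact fun h => ⟨_, h, fun i => rfl⟩
    · rintro ⟨v, hv, h⟩
      rwa [show (fun i => ⌊y i⌋) = v from funext h]
  rw [hset, (PiLp.volume_preserving_ofLp (Fin d)).measure_preimage
    (Finset.measurableSet_biUnion _ fun v _ => hm v).nullMeasurableSet,
    MeasureTheory.measure_biUnion_finset _ fun v _ => hm v]
  · simp [Real.volume_pi_Ico]
  · intro v _ w _ hvw
    refine Set.disjoint_left.2 fun y hy hy' => hvw (funext fun i => ?_)
    simp only [Set.mem_pi, Set.mem_univ, true_implies, Set.mem_Ico, ← Int.floor_eq_iff] at hy hy'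
    rw [← hy i, ← hy' i]

theorem mem_latticeBall_iff_norm {d n : ℕ} {v : Fin d → ℤ} :
    v ∈ latticeBall d n ↔ ‖WithLp.toLp 2 (fun i => (v i : ℝ))‖ ≤ √(n : ℝ) := by
  rw [mem_latticeBall, EuclideanSpace.norm_eq,
    Real.sqrt_le_sqrt_iff (Nat.cast_nonneg _)]
  simp only [Real.norm_eq_abs, sq_abs]
  exact_mod_cast Iff.rfl

theorem norm_sub_floor_le {d : ℕ} (y : EuclideanSpace ℝ (Fin d)) :
    ‖y - WithLp.toLp 2 (fun i => (⌊y i⌋ : ℝ))‖ ≤ √(d : ℝ) := by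
  rw [EuclideanSpace.norm_eq]
  refine Real.sqrt_le_sqrt ?_
  calc ∑ i, ‖(y - WithLp.toLp 2 (fun i => (⌊y i⌋ : ℝ))) i‖ ^ 2 ≤ ∑ i : Fin d, (1 : ℝ) := by
        refine Finset.sum_le_sum fun i _ => ?_
        simp only [PiLp.sub_apply, Real.norm_eq_abs, sq_abs]
        nlinarith [Int.floor_le (y i), Int.lt_floor_add_one (y i)]
    _ = d := by simp

theorem card_latticeBall_le {d : ℕ} (hd : 1 ≤ d) (n : ℕ) :
    ((latticeBall d n).card : ℝ) ≤ unitBallVolume d * (√(n : ℝ) + √(d : ℝ)) ^ d := by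
  have : Nonempty (Fin d) := ⟨⟨0, hd⟩⟩
  have hV := (unitBallVolume_pos d).le
  have h : ((latticeBall d n).card : ENNReal)
      ≤ ENNReal.ofReal (unitBallVolume d * (√(n : ℝ) + √(d : ℝ)) ^ d) := by
    rw [← volume_floor_mem, mul_comm, ENNReal.ofReal_mul (by positivity),
      ENNReal.ofReal_pow (by positivity)]
    have hb := EuclideanSpace.volume_closedBall (Fin d) 0 (√(n : ℝ) + √(d : ℝ))
    rw [Fintype.card_fin] at hb
    refine le_trans (MeasureTheory.measure_mono ?_) hb.le
    intro y hy
    have h1 := mem_latticeBall_iff_norm.1 hy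
    have h2 := norm_sub_floor_le y
    rw [mem_closedBall_zero_iff]
    have h3 := norm_add_le (y - WithLp.toLp 2 (fun i => (⌊y i⌋ : ℝ)))
      (WithLp.toLp 2 (fun i => (⌊y i⌋ : ℝ)))
    rw [sub_add_cancel] at h3
    linarith
  rw [← ENNReal.ofReal_natCast] at h
  exact (ENNReal.ofReal_le_ofReal_iff (by positivity)).1 h

theorem le_card_latticeBall {d : ℕ} (hd : 1 ≤ d) (n : ℕ) (h : √(d : ℝ) ≤ √(n : ℝ)) :
    unitBallVolume d * (√(n : ℝ) - √(d : ℝ)) ^ d ≤ (latticeBall d n).card := by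
  have : Nonempty (Fin d) := ⟨⟨0, hd⟩⟩
  have hV := (unitBallVolume_pos d).le
  have h0 : 0 ≤ √(n : ℝ) - √(d : ℝ) := sub_nonneg.2 h
  have h : ENNReal.ofReal (unitBallVolume d * (√(n : ℝ) - √(d : ℝ)) ^ d)
      ≤ ((latticeBall d n).card : ENNReal) := by
    rw [← volume_floor_mem, mul_comm, ENNReal.ofReal_mul (by positivity),
      ENNReal.ofReal_pow (by positivity)]
    have hb := EuclideanSpace.volume_closedBall (Fin d) 0 (√(n : ℝ) - √(d : ℝ))
    rw [Fintype.card_fin] at hb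
    refine le_trans hb.ge (MeasureTheory.measure_mono ?_)
    intro y hy
    have h2 := norm_sub_floor_le y
    rw [mem_closedBall_zero_iff] at hy
    refine mem_latticeBall_iff_norm.2 ?_
    have h3 := norm_sub_le y (y - WithLp.toLp 2 (fun i => (⌊y i⌋ : ℝ)))
    rw [sub_sub_cancel] at h3
    linarith
  rw [← ENNReal.ofReal_natCast] at h
  exact (ENNReal.ofReal_le_ofReal_iff (by positivity)).1 h

theorem abs_card_latticeBall_sub_le {d : ℕ} (hd : 1 ≤ d) :
    ∃ C : ℝ, 0 ≤ C ∧ ∀ n : ℕ, 1 ≤ n →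
      |((latticeBall d n).card : ℝ) - unitBallVolume d * √(n : ℝ) ^ d|
        ≤ C * √(n : ℝ) ^ (d - 1) := by
  have hV := (unitBallVolume_pos d).le
  set V := unitBallVolume d with hVdef
  set c := √(d : ℝ) with hc
  have hc0 : 0 ≤ c := Real.sqrt_nonneg _
  refine ⟨V * (c * d * (1 + c) ^ (d - 1)), by positivity, fun n hn => ?_⟩
  set R := √(n : ℝ) with hR
  have hR1 : 1 ≤ R := Real.one_le_sqrt.2 (by exact_mod_cast hn)
  have hR0 : 0 ≤ R := by linarith
  have hd1 : (1 : ℝ) ≤ d := by exact_mod_cast hd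
  have hpow : (R + c) ^ (d - 1) ≤ (1 + c) ^ (d - 1) * R ^ (d - 1) := by
    rw [← mul_pow]
    exact pow_le_pow_left₀ (by positivity) (by nlinarith) _
  have hRp : R ^ (d - 1) ≤ (1 + c) ^ (d - 1) * R ^ (d - 1) :=
    le_mul_of_one_le_left (by positivity) (one_le_pow₀ (by linarith))
  rw [abs_le]
  constructor
  · rcases le_total c R with h | h
    · have h1 := le_card_latticeBall hd n h
      have h2 := abs_pow_sub_pow_le R (R - c) d
      rw [sub_sub_cancel, abs_of_nonneg hc0, abs_of_nonneg hR0, abs_of_nonneg (sub_nonneg.2 h),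
        max_eq_left (by linarith)] at h2
      have h3 : R ^ d - (R - c) ^ d ≤ c * d * ((1 + c) ^ (d - 1) * R ^ (d - 1)) :=
        (le_abs_self _).trans (h2.trans (by gcongr))
      have h4 := mul_le_mul_of_nonneg_left h3 hV
      linarith
    · have h3 : R ^ d ≤ c * d * ((1 + c) ^ (d - 1) * R ^ (d - 1)) := by
        calc R ^ d = R * R ^ (d - 1) := by rw [← pow_succ', Nat.sub_add_cancel hd]
          _ ≤ c * d * ((1 + c) ^ (d - 1) * R ^ (d - 1)) := by
            gcongr
            nlinarith
      have h4 := mul_le_mul_of_nonneg_left h3 hV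
      have : (0 : ℝ) ≤ (latticeBall d n).card := Nat.cast_nonneg _
      linarith
  · have h1 := card_latticeBall_le hd n
    have h2 := abs_pow_sub_pow_le (R + c) R d
    rw [add_sub_cancel_left, abs_of_nonneg hc0, abs_of_nonneg hR0,
      abs_of_nonneg (by positivity : 0 ≤ R + c), max_eq_left (by linarith)] at h2
    have h3 : (R + c) ^ d - R ^ d ≤ c * d * ((1 + c) ^ (d - 1) * R ^ (d - 1)) :=
      (le_abs_self _).trans (h2.trans (by gcongr))
    have h4 := mul_le_mul_of_nonneg_left h3 hV
    linarith

theorem card_latticeBall_add_one {d : ℕ} (n : ℕ) :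
    (latticeBall d (n + 1)).card = (latticeBall d n).card
      + Nat.card {v : Fin d → ℤ // ∑ i, v i ^ 2 = ((n + 1 : ℕ) : ℤ)} := by
  have hsub : latticeBall d n ⊆ latticeBall d (n + 1) := fun v hv => by
    rw [mem_latticeBall] at hv ⊢
    push_cast
    linarith
  rw [Nat.subtype_card (latticeBall d (n + 1) \ latticeBall d n),
    add_comm (latticeBall d n).card, Finset.card_sdiff_add_card_eq_card hsub]
  intro v
  rw [Finset.mem_sdiff, mem_latticeBall, mem_latticeBall]
  push_cast
  omega

theorem abs_pow_sub_taylor_le {u : ℝ} (hu : 1 ≤ u) (n : ℕ) :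
    0 ≤ u ^ n - 1 - n * (u - 1) ∧ u ^ n - 1 - n * (u - 1) ≤ n ^ 2 * (u - 1) ^ 2 * u ^ n := by
  induction n with
  | zero => simp
  | succ n ih =>
    have h1 : u ^ (n + 1) - 1 - ((n + 1 : ℕ) : ℝ) * (u - 1)
        = u * (u ^ n - 1 - n * (u - 1)) + n * (u - 1) ^ 2 := by push_cast; ring
    rw [h1]
    have h0 : 0 ≤ u := by linarith
    have hp : 1 ≤ u ^ (n + 1) := one_le_pow₀ hu
    refine ⟨add_nonneg (mul_nonneg h0 ih.1) (by positivity), ?_⟩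
    have h2 := mul_le_mul_of_nonneg_left ih.2 h0
    have h3 : (n : ℝ) * (u - 1) ^ 2 ≤ n * (u - 1) ^ 2 * u ^ (n + 1) :=
      le_mul_of_one_le_right (by positivity) hp
    have h4 : 0 ≤ ((n : ℝ) + 1) * (u - 1) ^ 2 * u ^ (n + 1) := by positivity
    push_cast
    have h5 : ((n : ℝ) + 1) ^ 2 * (u - 1) ^ 2 * u ^ (n + 1)
        = u * (n ^ 2 * (u - 1) ^ 2 * u ^ n) + n * (u - 1) ^ 2 * u ^ (n + 1)
          + ((n : ℝ) + 1) * (u - 1) ^ 2 * u ^ (n + 1) := by ring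
    linarith

theorem abs_sqrt_pow_sub_taylor_le (d : ℕ) {s : ℝ} (hs : 0 ≤ s) :
    |√(1 + s) ^ d - 1 - d / 2 * s| ≤ ((d : ℝ) ^ 2 + d) * s ^ 2 * (1 + s) ^ d := by
  have hu : 1 ≤ √(1 + s) := Real.one_le_sqrt.2 (by linarith)
  have hus : √(1 + s) ^ 2 = 1 + s := Real.sq_sqrt (by linarith)
  set u := √(1 + s) with hudef
  obtain ⟨h1, h2⟩ := abs_pow_sub_taylor_le hu d
  have h3 : (u - 1) ^ 2 ≤ s ^ 2 := by
    refine pow_le_pow_left₀ (by linarith) ?_ 2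
    nlinarith
  have h4 : u ^ d ≤ (1 + s) ^ d := pow_le_pow_left₀ (by linarith) (by nlinarith) _
  have h5 : (d : ℝ) ^ 2 * (u - 1) ^ 2 * u ^ d ≤ (d : ℝ) ^ 2 * s ^ 2 * (1 + s) ^ d := by gcongr
  have h6 : (d : ℝ) / 2 * (u - 1) ^ 2 ≤ d * s ^ 2 * (1 + s) ^ d := by
    have h7 : (1 : ℝ) ≤ (1 + s) ^ d := one_le_pow₀ (by linarith)
    have h8 : (d : ℝ) * s ^ 2 ≤ d * s ^ 2 * (1 + s) ^ d :=
      le_mul_of_one_le_right (by positivity) h7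
    have h9 : (d : ℝ) / 2 * (u - 1) ^ 2 ≤ d / 2 * s ^ 2 := by gcongr
    have : 0 ≤ (d : ℝ) * s ^ 2 := by positivity
    linarith
  have h10 : u ^ d - 1 - d / 2 * s = (u ^ d - 1 - d * (u - 1)) - d / 2 * (u - 1) ^ 2 := by
    rw [show s = u ^ 2 - 1 by linarith]; ring
  have h11 : 0 ≤ (d : ℝ) / 2 * (u - 1) ^ 2 := by positivity
  rw [h10, abs_le]
  have : 0 ≤ (d : ℝ) ^ 2 * s ^ 2 * (1 + s) ^ d := by positivity
  have : 0 ≤ d * s ^ 2 * (1 + s) ^ d := by positivity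
  constructor <;> linarith

theorem summable_pow_mul_geometric {x : ℝ} (hx0 : 0 ≤ x) (hx1 : x < 1) (q : ℕ) :
    Summable fun i : ℕ => (i : ℝ) ^ q * x ^ i :=
  summable_pow_mul_geometric_of_norm_lt_one q (by rwa [Real.norm_of_nonneg hx0])

theorem tsum_pow_mul_geometric_le {x : ℝ} (hx0 : 0 ≤ x) (hx1 : x < 1) (q : ℕ) :
    ∑' i : ℕ, (i : ℝ) ^ q * x ^ i ≤ (q.factorial : ℝ) / (1 - x) ^ (q + 1) := by
  have hn : ‖x‖ < 1 := by rwa [Real.norm_of_nonneg hx0]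
  have h1 := summable_choose_mul_geometric_of_norm_lt_one q hn
  rw [← mul_one_div, ← tsum_choose_mul_geometric_of_norm_lt_one q hn, ← tsum_mul_left]
  refine (summable_pow_mul_geometric hx0 hx1 q).tsum_le_tsum (fun i => ?_) (h1.mul_left _)
  rw [← mul_assoc]
  refine mul_le_mul_of_nonneg_right ?_ (pow_nonneg hx0 _)
  have h2 : i ^ q ≤ (i + 1) ^ q := Nat.pow_le_pow_left (Nat.le_succ i) q
  have h3 := h2.trans (Nat.pow_succ_le_ascFactorial (i + 1) q)
  rw [Nat.ascFactorial_eq_factorial_mul_choose] at h3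
  exact_mod_cast h3

/-- Summation by parts against a geometric sequence. -/
theorem tsum_sub_mul_geometric {D : ℕ → ℝ} {x : ℝ} (h0 : D 0 = 0)
    (hD : Summable fun i => D i * x ^ i) :
    ∑' i, (D (i + 1) - D i) * x ^ (i + 1) = (1 - x) * ∑' i, D i * x ^ i := by
  have h1 : Summable fun i => D (i + 1) * x ^ (i + 1) :=
    (summable_nat_add_iff (f := fun i => D i * x ^ i) 1).2 hD
  have h2 := hD.tsum_eq_zero_add
  rw [h0, zero_mul, zero_add] at h2
  have h3 : ∀ i, (D (i + 1) - D i) * x ^ (i + 1)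
      = D (i + 1) * x ^ (i + 1) - x * (D i * x ^ i) := fun i => by ring
  rw [tsum_congr h3, h1.tsum_sub (hD.mul_left x), tsum_mul_left, ← h2]
  ring

theorem abs_card_latticeBall_increment_le {d : ℕ} (hd : 1 ≤ d) :
    ∃ C : ℝ, 0 ≤ C ∧ ∀ m i : ℕ, 1 ≤ m →
      |((latticeBall d (m + i)).card : ℝ) - (latticeBall d m).card
          - unitBallVolume d * (d / 2) * (√(m : ℝ) ^ d / m) * i|
        ≤ C * √(m : ℝ) ^ d
          * ((1 + (i / m : ℝ) ^ d) * ((i / m : ℝ) ^ 2 + 1 / √(m : ℝ))) := by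
  obtain ⟨C, hC, h⟩ := abs_card_latticeBall_sub_le hd
  have hV := (unitBallVolume_pos d).le
  set V := unitBallVolume d with hVdef
  refine ⟨(2 * C + V * ((d : ℝ) ^ 2 + d)) * 2 ^ (d - 1), by positivity, fun m i hm => ?_⟩
  have hm0 : (0 : ℝ) < m := by exact_mod_cast hm
  set R := √(m : ℝ) with hR
  have hR0 : 0 < R := Real.sqrt_pos.2 hm0
  set s : ℝ := i / m with hs
  have hs0 : 0 ≤ s := by positivity
  have hRi : √((m + i : ℕ) : ℝ) = R * √(1 + s) := by
    rw [hR, ← Real.sqrt_mul hm0.le, hs]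
    congr 1
    push_cast
    field_simp
  have h1 := h m hm
  have h2 := h (m + i) (by omega)
  rw [hRi] at h2
  have h3 := abs_sqrt_pow_sub_taylor_le d hs0
  have hu : 1 ≤ √(1 + s) := Real.one_le_sqrt.2 (by linarith)
  have hus : √(1 + s) ≤ 1 + s := by
    have : √(1 + s) ^ 2 = 1 + s := Real.sq_sqrt (by linarith)
    nlinarith
  have hRd : R ^ (d - 1) = R ^ d * (1 / R) := by
    rw [← Nat.sub_add_cancel hd, pow_succ]
    field_simp
    simp
  have h4 : (R * √(1 + s)) ^ (d - 1) ≤ R ^ d * (1 / R) * (1 + s) ^ d := by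
    rw [mul_pow, hRd]
    gcongr
    calc √(1 + s) ^ (d - 1) ≤ √(1 + s) ^ d := pow_le_pow_right₀ hu (Nat.sub_le _ _)
      _ ≤ (1 + s) ^ d := by gcongr
  have h5 : R ^ (d - 1) ≤ R ^ d * (1 / R) * (1 + s) ^ d := by
    rw [hRd]
    exact le_mul_of_one_le_right (by positivity) (one_le_pow₀ (by linarith))
  have h6 : (1 + s) ^ d ≤ 2 ^ (d - 1) * (1 + s ^ d) := by
    simpa using add_pow_le zero_le_one hs0 d
  have key : ((latticeBall d (m + i)).card : ℝ) - (latticeBall d m).card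
          - V * (d / 2) * (R ^ d / m) * i
      = (((latticeBall d (m + i)).card : ℝ) - V * (R * √(1 + s)) ^ d)
        - (((latticeBall d m).card : ℝ) - V * R ^ d)
        + V * R ^ d * (√(1 + s) ^ d - 1 - d / 2 * s) := by
    rw [hs, mul_pow]
    field_simp
    ring
  rw [key]
  calc _ ≤ |((latticeBall d (m + i)).card : ℝ) - V * (R * √(1 + s)) ^ d|
        + |((latticeBall d m).card : ℝ) - V * R ^ d|
        + |V * R ^ d * (√(1 + s) ^ d - 1 - d / 2 * s)| :=
        (abs_add_le _ _).trans (by gcongr; exact abs_sub _ _)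
    _ ≤ C * (R ^ d * (1 / R) * (1 + s) ^ d) + C * (R ^ d * (1 / R) * (1 + s) ^ d)
        + V * R ^ d * (((d : ℝ) ^ 2 + d) * s ^ 2 * (1 + s) ^ d) := by
        rw [abs_mul, abs_of_nonneg (by positivity : 0 ≤ V * R ^ d)]
        gcongr
        · exact h2.trans (by gcongr)
        · exact h1.trans (by gcongr)
    _ = (2 * C * (1 / R) + V * ((d : ℝ) ^ 2 + d) * s ^ 2) * R ^ d * (1 + s) ^ d := by ring
    _ ≤ ((2 * C + V * ((d : ℝ) ^ 2 + d)) * (s ^ 2 + 1 / R)) * R ^ d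
        * (2 ^ (d - 1) * (1 + s ^ d)) := by
        gcongr
        have e1 : 0 ≤ 2 * C * s ^ 2 := by positivity
        have e2 : 0 ≤ V * ((d : ℝ) ^ 2 + d) * (1 / R) := by positivity
        linarith
    _ = _ := by ring

theorem summable_card_latticeBall_increment {d : ℕ} (hd : 1 ≤ d) {x : ℝ} (hx0 : 0 ≤ x)
    (hx1 : x < 1) (m : ℕ) :
    Summable fun i : ℕ =>
      (((latticeBall d (m + i)).card : ℝ) - (latticeBall d m).card) * x ^ i := by
  have hV := (unitBallVolume_pos d).le
  have S := summable_pow_mul_geometric hx0 hx1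
  have h1 : Summable fun i : ℕ => ((latticeBall d (m + i)).card : ℝ) * x ^ i := by
    refine Summable.of_nonneg_of_le (fun i => by positivity) (fun i => ?_)
      (((S 0).mul_left (unitBallVolume d * 2 ^ (d - 1) * ((m : ℝ) + d) ^ d)).add
        ((S d).mul_left (unitBallVolume d * 2 ^ (d - 1))))
    have hsq : ∀ n : ℕ, √(n : ℝ) ≤ n := fun n =>
      by
      rw [Real.sqrt_le_left (Nat.cast_nonneg n)]
      exact_mod_cast Nat.le_self_pow two_ne_zero n
    have h2 : ((latticeBall d (m + i)).card : ℝ)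
        ≤ unitBallVolume d * (2 ^ (d - 1) * (((m : ℝ) + d) ^ d + (i : ℝ) ^ d)) := by
      refine (card_latticeBall_le hd (m + i)).trans ?_
      gcongr
      refine le_trans ?_ (add_pow_le (by positivity) (by positivity) d)
      refine pow_le_pow_left₀ (by positivity) ?_ d
      have e1 := hsq (m + i)
      have e2 := hsq d
      push_cast at e1 ⊢
      linarith
    have h3 := mul_le_mul_of_nonneg_right h2 (pow_nonneg hx0 i)
    refine h3.trans (le_of_eq ?_)
    ring
  refine (h1.sub ((S 0).mul_left ((latticeBall d m).card : ℝ))).congr fun i => ?_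
  ring

/-- The tail `∑_{k > m} j_d(k) x^k`, divided by its expected order of magnitude. -/
theorem abs_tsum_increment_sub_le {d : ℕ} (hd : 1 ≤ d) :
    ∃ C : ℝ, 0 ≤ C ∧ ∀ (x : ℝ) (m : ℕ), 0 ≤ x → x < 1 → 1 ≤ m →
      |(1 - x) ^ 2 * (m / √(m : ℝ) ^ d) * ∑' i : ℕ,
          (((latticeBall d (m + i)).card : ℝ) - (latticeBall d m).card) * x ^ i
        - unitBallVolume d * (d / 2) * x|
      ≤ C * (2 / (m * (1 - x)) + (d + 2).factorial / (m * (1 - x)) ^ (d + 1)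
          + √(m : ℝ) * (1 - x) * (1 + d.factorial / (m * (1 - x)) ^ d)) := by
  obtain ⟨C, hC, h⟩ := abs_card_latticeBall_increment_le hd
  refine ⟨C, hC, fun x m hx0 hx1 hm => ?_⟩
  set D : ℕ → ℝ := fun i => ((latticeBall d (m + i)).card : ℝ) - (latticeBall d m).card with hD
  have hm0 : (0 : ℝ) < m := by exact_mod_cast hm
  have hR0 : 0 < √(m : ℝ) := Real.sqrt_pos.2 hm0
  have hR2 : √(m : ℝ) ^ 2 = m := Real.sq_sqrt hm0.le
  set R := √(m : ℝ) with hR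
  have hy : 0 < 1 - x := by linarith
  have hSD : Summable fun i => D i * x ^ i := summable_card_latticeBall_increment hd hx0 hx1 m
  have S := summable_pow_mul_geometric hx0 hx1
  have T := tsum_pow_mul_geometric_le hx0 hx1
  have hid : HasSum (fun i : ℕ => (i : ℝ) * x ^ i) (x / (1 - x) ^ 2) :=
    hasSum_coe_mul_geometric_of_norm_lt_one (by rwa [Real.norm_of_nonneg hx0])
  set E : ℕ → ℝ := fun i => D i * x ^ i
    - unitBallVolume d * (d / 2) * (R ^ d / m) * (i * x ^ i) with hE
  set B : ℕ → ℝ := fun i => C * R ^ d * (1 / (m : ℝ) ^ 2 * ((i : ℝ) ^ 2 * x ^ i)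
    + 1 / (m : ℝ) ^ (d + 2) * ((i : ℝ) ^ (d + 2) * x ^ i)
    + 1 / R * (((i : ℝ) ^ 0 * x ^ i) + 1 / (m : ℝ) ^ d * ((i : ℝ) ^ d * x ^ i))) with hB
  have hEB : ∀ i, |E i| ≤ B i := by
    intro i
    have h1 := mul_le_mul_of_nonneg_right (h m i hm) (pow_nonneg hx0 i)
    rw [← abs_of_nonneg (pow_nonneg hx0 i), ← abs_mul, abs_of_nonneg (pow_nonneg hx0 i)] at h1
    refine le_trans (le_of_eq ?_) (h1.trans (le_of_eq ?_))
    · simp only [hE, hD, hR]; ring_nf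
    · simp only [hB, div_pow]; field_simp; ring
  have hSB : Summable B := ((((S 2).mul_left _).add ((S (d + 2)).mul_left _)).add
    (((S 0).add ((S d).mul_left _)).mul_left _)).mul_left _
  have hTB : ∑' i, B i ≤ C * R ^ d * (1 / (m : ℝ) ^ 2 * (2 / (1 - x) ^ 3)
    + 1 / (m : ℝ) ^ (d + 2) * ((d + 2).factorial / (1 - x) ^ (d + 3))
    + 1 / R * (1 / (1 - x) + 1 / (m : ℝ) ^ d * (d.factorial / (1 - x) ^ (d + 1)))) := by
    rw [hB, tsum_mul_left, Summable.tsum_add (((S 2).mul_left _).add ((S (d + 2)).mul_left _))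
      (((S 0).add ((S d).mul_left _)).mul_left _), Summable.tsum_add ((S 2).mul_left _)
      ((S (d + 2)).mul_left _), tsum_mul_left, tsum_mul_left, tsum_mul_left,
      Summable.tsum_add (S 0) ((S d).mul_left _), tsum_mul_left]
    have t2 := T 2
    have t0 := T 0
    norm_num at t2
    simp only [Nat.factorial_zero, Nat.cast_one, zero_add, pow_one] at t0
    gcongr
    · exact T (d + 2)
    · exact T d
  have hlim : (1 - x) ^ 2 * (m / R ^ d) * ∑' i : ℕ, D i * x ^ i
        - unitBallVolume d * (d / 2) * x = (1 - x) ^ 2 * (m / R ^ d) * ∑' i, E i := by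
    rw [hE, Summable.tsum_sub hSD (hid.summable.mul_left _), tsum_mul_left, hid.tsum_eq]
    field_simp
  have habs : |∑' i, E i| ≤ ∑' i, B i :=
    tsum_of_norm_bounded (f := E) hSB.hasSum hEB
  rw [hlim, abs_mul, abs_of_nonneg (by positivity)]
  calc _ ≤ _ := mul_le_mul_of_nonneg_left (habs.trans hTB) (by positivity)
    _ = _ := by
      rw [← hR2, mul_pow, mul_pow]
      field_simp
      ring

theorem tprod_tail_mem_Icc {j : ℕ → ℕ} {x : ℝ} (hx0 : 0 < x) (hx1 : x < 1) {m : ℕ} (hm : 1 ≤ m)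
    (hS : Summable fun i : ℕ => (j (i + (m + 1)) : ℝ) * x ^ (i + (m + 1))) :
    (∏' k : ℕ, if m < k then (1 - x ^ k) ^ j k else 1) ∈ Set.Icc
      (Real.exp (-((∑' i : ℕ, (j (i + (m + 1)) : ℝ) * x ^ (i + (m + 1))) / (1 - x ^ m))))
      (Real.exp (-∑' i : ℕ, (j (i + (m + 1)) : ℝ) * x ^ (i + (m + 1)))) := by
  set f : ℕ → ℝ := fun k => if m < k then (1 - x ^ k) ^ j k else 1 with hf
  set g : ℕ → ℝ := fun k => if m < k then (j k : ℝ) * x ^ k else 0 with hg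
  have hgi : ∀ i, g (i + (m + 1)) = (j (i + (m + 1)) : ℝ) * x ^ (i + (m + 1)) := fun i =>
    if_pos (by omega)
  have hgs : Summable g := (summable_nat_add_iff (m + 1)).1 (hS.congr fun i => (hgi i).symm)
  have hgt : ∑' i : ℕ, (j (i + (m + 1)) : ℝ) * x ^ (i + (m + 1)) = ∑' k, g k := by
    rw [← hgs.sum_add_tsum_nat_add (m + 1), Finset.sum_eq_zero, zero_add]
    · exact tsum_congr fun i => (hgi i).symm
    · intro k hk
      exact if_neg (by have := Finset.mem_range.1 hk; omega)
  rw [hgt]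
  have hpow : ∀ k : ℕ, 1 ≤ k → x ^ k < 1 := fun k hk =>
    pow_lt_one₀ hx0.le hx1 (by omega)
  have hfpos : ∀ k, 0 < f k := by
    intro k
    simp only [hf]
    split_ifs with h
    · have := hpow k (by omega)
      exact pow_pos (by linarith) _
    · exact one_pos
  have hub : ∀ k, Real.log (f k) ≤ -g k := by
    intro k
    simp only [hf, hg]
    split_ifs with h
    · have h1 := hpow k (by omega)
      have h2 := Real.log_le_sub_one_of_pos (by linarith : 0 < 1 - x ^ k)
      rw [Real.log_pow]
      have := mul_le_mul_of_nonneg_left h2 (Nat.cast_nonneg (α := ℝ) (j k))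
      linarith
    · simp
  have hlb : ∀ k, -(g k / (1 - x ^ m)) ≤ Real.log (f k) := by
    intro k
    simp only [hf, hg]
    split_ifs with h
    · have h1 := hpow k (by omega)
      have h1m := hpow m hm
      have h2 := Real.one_sub_inv_le_log_of_pos (by linarith : 0 < 1 - x ^ k)
      have h3 : x ^ k ≤ x ^ m := pow_le_pow_of_le_one hx0.le hx1.le h.le
      have hk0 : 0 < 1 - x ^ k := by linarith
      have hm0 : 0 < 1 - x ^ m := by linarith
      have h4 : -(x ^ k / (1 - x ^ m)) ≤ 1 - (1 - x ^ k)⁻¹ := by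
        have h5 : 1 - (1 - x ^ k)⁻¹ = -(x ^ k / (1 - x ^ k)) := by field_simp; ring
        rw [h5, neg_le_neg_iff]
        gcongr
      rw [Real.log_pow]
      have := mul_le_mul_of_nonneg_left (h4.trans h2) (Nat.cast_nonneg (α := ℝ) (j k))
      refine le_trans (le_of_eq ?_) this
      ring
    · simp
  have hls : Summable fun k => Real.log (f k) := by
    have h1 : Summable fun k => -g k - Real.log (f k) := by
      refine Summable.of_nonneg_of_le (fun k => by linarith [hub k]) (fun k => ?_)
        ((hgs.div_const (1 - x ^ m)).sub hgs)
      linarith [hlb k]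
    exact (hgs.neg.sub h1).congr fun k => by ring
  rw [← Real.rexp_tsum_eq_tprod hfpos hls, ← tsum_div_const, ← tsum_neg, ← tsum_neg]
  exact ⟨Real.exp_le_exp.2 ((hgs.div_const _).neg.tsum_le_tsum hlb hls),
    Real.exp_le_exp.2 (hls.tsum_le_tsum hub hgs.neg)⟩

theorem tsum_tail_eq {d : ℕ} (hd : 1 ≤ d) {j : ℕ → ℕ}
    (hj : ∀ k : ℕ, j k = Nat.card {v : Fin d → ℤ // ∑ i, (v i) ^ 2 = (k : ℤ)})
    {x : ℝ} (hx0 : 0 ≤ x) (hx1 : x < 1) (m : ℕ) :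
    (Summable fun i : ℕ => (j (i + (m + 1)) : ℝ) * x ^ (i + (m + 1))) ∧
    ∑' i : ℕ, (j (i + (m + 1)) : ℝ) * x ^ (i + (m + 1))
      = x ^ m * ((1 - x) * ∑' i : ℕ,
          (((latticeBall d (m + i)).card : ℝ) - (latticeBall d m).card) * x ^ i) := by
  have hs := summable_card_latticeBall_increment hd hx0 hx1 m
  set D : ℕ → ℝ := fun i => ((latticeBall d (m + i)).card : ℝ) - (latticeBall d m).card with hD
  have hterm : ∀ i : ℕ, (j (i + (m + 1)) : ℝ) * x ^ (i + (m + 1))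
      = x ^ m * ((D (i + 1) - D i) * x ^ (i + 1)) := by
    intro i
    have h1 := card_latticeBall_add_one (d := d) (m + i)
    rw [← hj, show m + i + 1 = i + (m + 1) by ring] at h1
    have h2 : D (i + 1) - D i = j (i + (m + 1)) := by
      simp only [hD]
      rw [show m + (i + 1) = i + (m + 1) by ring, h1]
      push_cast
      ring
    rw [h2]
    ring
  have hsub : Summable fun i => (D (i + 1) - D i) * x ^ (i + 1) :=
    (((summable_nat_add_iff (f := fun i => D i * x ^ i) 1).2 hs).sub (hs.mul_left x)).congr
      fun i => by ring
  refine ⟨(hsub.mul_left (x ^ m)).congr fun i => (hterm i).symm, ?_⟩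
  rw [tsum_congr hterm, tsum_mul_left, tsum_sub_mul_geometric (by simp) hs]

/-- If `m (1 - x) → ∞` and `√m (1 - x) → 0`, the number of lattice points in a shell starting at
`√m` satisfies the expected Abelian asymptotics. -/
theorem tendsto_tsum_increment {d : ℕ} (hd : 1 ≤ d) {m : ℝ → ℕ}
    (hm : Tendsto (fun x : ℝ => (m x : ℝ) * (1 - x)) (𝓝[<] 1) atTop)
    (hm' : Tendsto (fun x : ℝ => √(m x : ℝ) * (1 - x)) (𝓝[<] 1) (𝓝 0)) :
    Tendsto (fun x : ℝ => (1 - x) ^ 2 * (m x / √(m x : ℝ) ^ d) * ∑' i : ℕ,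
        (((latticeBall d (m x + i)).card : ℝ) - (latticeBall d (m x)).card) * x ^ i)
      (𝓝[<] 1) (𝓝 (unitBallVolume d * (d / 2))) := by
  obtain ⟨C, -, h⟩ := abs_tsum_increment_sub_le hd
  have hx : Tendsto (fun x : ℝ => x) (𝓝[<] 1) (𝓝 1) := tendsto_nhdsWithin_of_tendsto_nhds tendsto_id
  have hIoo : ∀ᶠ x : ℝ in 𝓝[<] 1, x ∈ Set.Ioo (0 : ℝ) 1 := Ioo_mem_nhdsLT one_pos
  have hp : ∀ q : ℕ, q ≠ 0 → ∀ c : ℝ,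
      Tendsto (fun x : ℝ => c / ((m x : ℝ) * (1 - x)) ^ q) (𝓝[<] 1) (𝓝 0) := fun q hq c =>
    tendsto_const_nhds.div_atTop ((tendsto_pow_atTop hq).comp hm)
  have hbound := (((hp 1 one_ne_zero 2).add (hp (d + 1) (by omega) (d + 2).factorial)).add
    (hm'.mul ((hp d (by omega) d.factorial).const_add 1))).const_mul C
  have hdiff := squeeze_zero_norm' (f := fun x : ℝ => (1 - x) ^ 2 * (m x / √(m x : ℝ) ^ d) *
    ∑' i : ℕ, (((latticeBall d (m x + i)).card : ℝ) - (latticeBall d (m x)).card) * x ^ i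
      - unitBallVolume d * (d / 2) * x) ?_ (by simpa using hbound)
  · have := hdiff.add (hx.const_mul (unitBallVolume d * (d / 2)))
    simpa using this
  · filter_upwards [hIoo, hm.eventually_ge_atTop 1] with x hx hmx
    have hm1 : 1 ≤ m x := by
      rcases Nat.eq_zero_or_pos (m x) with h0 | h0
      · rw [h0] at hmx; norm_num at hmx
      · exact h0
    simpa using h x (m x) hx.1.le hx.2 hm1

theorem tendsto_abs_log_one_sub :
    Tendsto (fun x : ℝ => |Real.log (1 - x)|) (𝓝[<] 1) atTop := by
  have h : Tendsto (fun x : ℝ => 1 - x) (𝓝[<] 1) (𝓝[>] 0) := by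
    refine tendsto_nhdsWithin_iff.2 ⟨?_, ?_⟩
    · refine tendsto_nhdsWithin_of_tendsto_nhds ?_
      simpa using (tendsto_id (α := ℝ) (x := 𝓝 1)).const_sub 1
    · filter_upwards [self_mem_nhdsWithin] with x hx
      exact sub_pos.2 (Set.mem_Iio.1 hx)
  exact tendsto_abs_atBot_atTop.comp (Real.tendsto_log_nhdsGT_zero.comp h)

theorem tendsto_abs_log_mul_one_sub :
    Tendsto (fun x : ℝ => |Real.log (1 - x)| * (1 - x)) (𝓝[<] 1) (𝓝 0) := by
  have h : Tendsto (fun x : ℝ => 1 - x) (𝓝[<] 1) (𝓝 0) := by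
    refine tendsto_nhdsWithin_of_tendsto_nhds ?_
    simpa using (tendsto_id (α := ℝ) (x := 𝓝 1)).const_sub 1
  have h2 := ((Real.continuous_mul_log.tendsto 0).comp h).abs
  simp only [Function.comp_def, Real.log_zero, mul_zero, abs_zero] at h2
  refine h2.congr' ?_
  filter_upwards [self_mem_nhdsWithin] with x hx
  rw [abs_mul, abs_of_pos (sub_pos.2 (Set.mem_Iio.1 hx)), mul_comm]

theorem tendsto_nat_pow_mul_exp {B : ℝ → ℝ} {m : ℝ → ℕ}
    (hwB : Tendsto (fun x : ℝ => (m x : ℝ) * (1 - x) - B x) (𝓝[<] 1) (𝓝 0))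
    (hm : Tendsto (fun x : ℝ => (m x : ℝ) * (1 - x) * (1 - x)) (𝓝[<] 1) (𝓝 0)) :
    Tendsto (fun x : ℝ => x ^ m x * Real.exp (B x)) (𝓝[<] 1) (𝓝 1) := by
  have hx : Tendsto (fun x : ℝ => x) (𝓝[<] 1) (𝓝 1) := tendsto_nhdsWithin_of_tendsto_nhds tendsto_id
  have hIoo : ∀ᶠ x : ℝ in 𝓝[<] 1, x ∈ Set.Ioo (0 : ℝ) 1 := Ioo_mem_nhdsLT one_pos
  have h1 : Tendsto (fun x : ℝ => (m x : ℝ) * (Real.log x + (1 - x))) (𝓝[<] 1) (𝓝 0) := by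
    refine squeeze_zero_norm' ?_ (by simpa using hm.div hx one_ne_zero)
    filter_upwards [hIoo] with x hx
    have e1 := Real.log_le_sub_one_of_pos hx.1
    have e2 := Real.one_sub_inv_le_log_of_pos hx.1
    have e3 : 1 - x⁻¹ + (1 - x) = -((1 - x) * (1 - x) / x) := by
      have := hx.1.ne'
      field_simp
      ring
    rw [Pi.div_apply, Real.norm_eq_abs, abs_mul, Nat.abs_cast, mul_assoc, mul_div_assoc]
    refine mul_le_mul_of_nonneg_left ?_ (Nat.cast_nonneg _)
    rw [abs_of_nonpos (by linarith)]
    linarith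
  have h2 := (Real.continuous_exp.tendsto _).comp (h1.sub hwB)
  simp only [sub_zero, Real.exp_zero] at h2
  refine h2.congr' ?_
  filter_upwards [hIoo] with x hx
  rw [Function.comp_apply, ← Real.exp_log (pow_pos hx.1 (m x)), ← Real.exp_add, Real.log_pow]
  congr 1
  ring

theorem sqrt_pow_div_eq {d : ℕ} {m ε V t : ℝ} (hm : 0 < m) (hε : 0 < ε)
    (hL : 0 < -Real.log ε) :
    √m ^ d / (m * ε) = Real.exp ((d : ℝ) / 2 * -Real.log ε
          + ((d : ℝ) - 2) / 2 * Real.log (-Real.log ε)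
          + (d : ℝ) / 2 * Real.log ((d : ℝ) / 2) + Real.log V + t)
      * (((m * ε) / -Real.log ε) ^ ((d : ℝ) / 2 - 1)
        * Real.exp (-t - (d : ℝ) / 2 * Real.log ((d : ℝ) / 2) - Real.log V)) := by
  have h1 : √m ^ d = Real.exp (Real.log m * ((d : ℝ) / 2)) := by
    rw [← Real.exp_log (Real.sqrt_pos.2 hm), ← Real.exp_nat_mul, Real.log_sqrt hm.le]
    congr 1
    ring
  have hw : 0 < m * ε := mul_pos hm hε
  have h2 : m * ε = Real.exp (Real.log m + Real.log ε) := by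
    rw [Real.exp_add, Real.exp_log hm, Real.exp_log hε]
  rw [Real.rpow_def_of_pos (div_pos hw hL), Real.log_div hw.ne' hL.ne', Real.log_mul hm.ne' hε.ne',
    h1, h2, ← Real.exp_sub, ← Real.exp_add, ← Real.exp_add]
  congr 1
  ring

/-- **Theorem 2 (maximal energy in the d-dimensional ideal Bose gas).** With
`j_d(k)` the number of lattice points of `ℤ^d` on the sphere of radius `√k` and
the centering `A(x) = (d/2)|log(1-x)| + ((d-2)/2) log|log(1-x)| + (d/2) log(d/2)
+ log(π^{d/2}/Γ(d/2+1))`, the probability `∏_{k > (A(x)+t)/(1-x)} (1-x^k)^{j_d(k)}`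
tends to the Gumbel distribution function `exp (-exp (-t))` as `x → 1⁻`. -/
theorem stmt_6 (d : ℕ) (hd : 1 ≤ d)
    (jd : ℕ → ℕ)
    (hjd : ∀ k : ℕ, jd k = Nat.card {v : Fin d → ℤ // ∑ i, (v i) ^ 2 = (k : ℤ)})
    (A : ℝ → ℝ)
    (hA : ∀ x : ℝ, A x = ((d : ℝ) / 2) * |Real.log (1 - x)|
      + (((d : ℝ) - 2) / 2) * Real.log |Real.log (1 - x)|
      + ((d : ℝ) / 2) * Real.log ((d : ℝ) / 2)
      + Real.log (Real.pi ^ ((d : ℝ) / 2) / Real.Gamma ((d : ℝ) / 2 + 1)))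
    (t : ℝ) :
    Tendsto (fun x : ℝ => ∏' k : ℕ,
        if (A x + t) / (1 - x) < (k : ℝ) then (1 - x ^ k) ^ (jd k) else 1)
      (𝓝[<] (1 : ℝ)) (𝓝 (Real.exp (-Real.exp (-t)))) := by
  have ha : 0 < (d : ℝ) / 2 := by
    have : (0 : ℝ) < d := by exact_mod_cast hd
    positivity
  have hV := unitBallVolume_pos d
  have hVeq : Real.pi ^ ((d : ℝ) / 2) / Real.Gamma ((d : ℝ) / 2 + 1) = unitBallVolume d := by
    rw [unitBallVolume, Real.sqrt_eq_rpow, ← Real.rpow_natCast, ← Real.rpow_mul Real.pi_pos.le]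
    congr 2
    ring
  rw [hVeq] at hA
  set V := unitBallVolume d with hVdef
  have hIoo : ∀ᶠ x : ℝ in 𝓝[<] 1, x ∈ Set.Ioo (0 : ℝ) 1 := Ioo_mem_nhdsLT one_pos
  have hε : Tendsto (fun x : ℝ => 1 - x) (𝓝[<] 1) (𝓝 0) := by
    refine tendsto_nhdsWithin_of_tendsto_nhds ?_
    simpa using (tendsto_id (α := ℝ) (x := 𝓝 1)).const_sub 1
  have hL := tendsto_abs_log_one_sub
  have hLε := tendsto_abs_log_mul_one_sub
  set L : ℝ → ℝ := fun x => |Real.log (1 - x)| with hLdef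
  have hL0 : ∀ᶠ x in 𝓝[<] 1, 0 < L x := hL.eventually_gt_atTop 0
  have hBL : Tendsto (fun x => (A x + t) / L x) (𝓝[<] 1) (𝓝 ((d : ℝ) / 2)) := by
    have h1 := Real.isLittleO_log_id_atTop.tendsto_div_nhds_zero.comp hL
    have h2 := (hL.inv_tendsto_atTop.const_mul
      ((d : ℝ) / 2 * Real.log ((d : ℝ) / 2) + Real.log V + t)).add
      (h1.const_mul (((d : ℝ) - 2) / 2))
    have h3 := h2.const_add ((d : ℝ) / 2)
    simp only [mul_zero, add_zero] at h3
    refine h3.congr' ?_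
    filter_upwards [hL0] with x hx
    rw [hA]
    change 0 < |Real.log (1 - x)| at hx
    simp only [Function.comp_apply, Pi.inv_apply, id, hLdef]
    field_simp
    ring
  have hB : Tendsto (fun x => A x + t) (𝓝[<] 1) atTop := by
    refine (hBL.pos_mul_atTop ha hL).congr' ?_
    filter_upwards [hL0] with x hx
    exact div_mul_cancel₀ _ hx.ne'
  have hBε : Tendsto (fun x => (A x + t) * (1 - x)) (𝓝[<] 1) (𝓝 0) := by
    have h := hBL.mul hLε
    rw [mul_zero] at h
    refine h.congr' ?_
    filter_upwards [hL0] with x hx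
    rw [← mul_assoc, div_mul_cancel₀ _ hx.ne']
  set m : ℝ → ℕ := fun x => ⌊(A x + t) / (1 - x)⌋₊ with hm
  have hwB : Tendsto (fun x => (m x : ℝ) * (1 - x) - (A x + t)) (𝓝[<] 1) (𝓝 0) := by
    refine squeeze_zero_norm' ?_ hε
    filter_upwards [hIoo, hB.eventually_ge_atTop 0] with x hx hBx
    have hy : 0 < 1 - x := sub_pos.2 hx.2
    have h1 := Nat.floor_le (div_nonneg hBx hy.le)
    have h2 := (Nat.lt_floor_add_one ((A x + t) / (1 - x))).le
    rw [le_div_iff₀ hy] at h1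
    rw [div_le_iff₀ hy] at h2
    rw [Real.norm_eq_abs, abs_le]
    constructor <;> linarith
  have hw : Tendsto (fun x => (m x : ℝ) * (1 - x)) (𝓝[<] 1) atTop := by
    refine (hwB.add_atTop hB).congr fun x => ?_
    ring
  have hwL : Tendsto (fun x => (m x : ℝ) * (1 - x) / L x) (𝓝[<] 1) (𝓝 ((d : ℝ) / 2)) := by
    have h := hBL.add (hwB.div_atTop hL)
    rw [add_zero] at h
    refine h.congr fun x => ?_
    ring
  have hwε : Tendsto (fun x => (m x : ℝ) * (1 - x) * (1 - x)) (𝓝[<] 1) (𝓝 0) := by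
    have h := hBε.add (hwB.mul hε)
    rw [mul_zero, add_zero] at h
    refine h.congr fun x => ?_
    ring
  have hsqrt : Tendsto (fun x => √(m x : ℝ) * (1 - x)) (𝓝[<] 1) (𝓝 0) := by
    have h := (Real.continuous_sqrt.tendsto 0).comp hwε
    rw [Real.sqrt_zero] at h
    refine h.congr' ?_
    filter_upwards [hIoo] with x hx
    rw [Function.comp_apply, mul_assoc, Real.sqrt_mul (Nat.cast_nonneg _),
      Real.sqrt_mul_self (sub_pos.2 hx.2).le]
  have hP := tendsto_nat_pow_mul_exp hwB hwε
  have hxm : Tendsto (fun x => x ^ m x) (𝓝[<] 1) (𝓝 0) := by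
    have h := hP.mul (Real.tendsto_exp_neg_atTop_nhds_zero.comp hB)
    rw [mul_zero] at h
    refine h.congr fun x => ?_
    rw [Function.comp_apply, mul_assoc, ← Real.exp_add, add_neg_cancel, Real.exp_zero, mul_one]
  have hm1 : ∀ᶠ x in 𝓝[<] 1, 1 ≤ m x := by
    filter_upwards [hw.eventually_gt_atTop 0] with x hx
    rcases Nat.eq_zero_or_pos (m x) with h0 | h0
    · rw [h0] at hx; norm_num at hx
    · exact h0
  have hS : Tendsto (fun x => ∑' i : ℕ, (jd (i + (m x + 1)) : ℝ) * x ^ (i + (m x + 1)))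
      (𝓝[<] 1) (𝓝 (Real.exp (-t))) := by
    have h1 := (tendsto_tsum_increment hd hw hsqrt).mul (hP.mul ((hwL.rpow_const
      (p := (d : ℝ) / 2 - 1) (Or.inl ha.ne')).mul_const
        (Real.exp (-t - (d : ℝ) / 2 * Real.log ((d : ℝ) / 2) - Real.log V))))
    have hlim : V * ((d : ℝ) / 2) * (1 * (((d : ℝ) / 2) ^ ((d : ℝ) / 2 - 1)
        * Real.exp (-t - (d : ℝ) / 2 * Real.log ((d : ℝ) / 2) - Real.log V)))
        = Real.exp (-t) := by
      nth_rewrite 1 [← Real.exp_log hV]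
      nth_rewrite 1 [← Real.exp_log ha]
      rw [Real.rpow_def_of_pos ha, one_mul, ← Real.exp_add, ← Real.exp_add, ← Real.exp_add]
      congr 1
      ring
    rw [← hVdef, hlim] at h1
    refine h1.congr' ?_
    filter_upwards [hIoo, hL0, hm1] with x hx hLx hmx
    have hy : 0 < 1 - x := sub_pos.2 hx.2
    have hm0 : (0 : ℝ) < m x := by exact_mod_cast hmx
    have hR0 : 0 < √(m x : ℝ) := Real.sqrt_pos.2 hm0
    have hLeq : L x = -Real.log (1 - x) :=
      abs_of_nonpos (Real.log_nonpos hy.le (by linarith [hx.1]))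
    have hc := sqrt_pow_div_eq (V := V) (d := d) (t := t) hm0 hy (hLeq ▸ hLx)
    have hAx : A x = (d : ℝ) / 2 * L x + ((d : ℝ) - 2) / 2 * Real.log (L x)
      + (d : ℝ) / 2 * Real.log ((d : ℝ) / 2) + Real.log V := hA x
    rw [← hLeq, ← hAx] at hc
    rw [(tsum_tail_eq hd hjd hx.1.le hx.2 (m x)).2, mul_assoc (x ^ m x), ← hc]
    field_simp
  have hlow : Tendsto (fun x => Real.exp
      (-((∑' i : ℕ, (jd (i + (m x + 1)) : ℝ) * x ^ (i + (m x + 1))) / (1 - x ^ m x))))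
      (𝓝[<] 1) (𝓝 (Real.exp (-Real.exp (-t)))) := by
    have h := (hS.div (hxm.const_sub 1) (by norm_num)).neg
    rw [sub_zero, div_one] at h
    exact (Real.continuous_exp.tendsto _).comp h
  have hup := (Real.continuous_exp.tendsto _).comp hS.neg
  have hmem : ∀ᶠ x in 𝓝[<] 1, (∏' k : ℕ,
      if (A x + t) / (1 - x) < (k : ℝ) then (1 - x ^ k) ^ (jd k) else 1) ∈ Set.Icc
        (Real.exp
          (-((∑' i : ℕ, (jd (i + (m x + 1)) : ℝ) * x ^ (i + (m x + 1))) / (1 - x ^ m x))))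
        (Real.exp (-∑' i : ℕ, (jd (i + (m x + 1)) : ℝ) * x ^ (i + (m x + 1)))) := by
    filter_upwards [hIoo, hm1, hB.eventually_ge_atTop 0] with x hx hmx hBx
    have hM : 0 ≤ (A x + t) / (1 - x) := div_nonneg hBx (sub_pos.2 hx.2).le
    simp only [← Nat.floor_lt hM]
    exact tprod_tail_mem_Icc hx.1 hx.2 hmx (tsum_tail_eq hd hjd hx.1.le hx.2 (m x)).1
  exact tendsto_of_tendsto_of_tendsto_of_le_of_le' hlow hup
    (hmem.mono fun x hx => hx.1) (hmem.mono fun x hx => hx.2)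
end
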